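/- (GL_3(ℝ): a fully reducible parameter and a parameter with a 2-dimensional constituent cannot have the same central character and the same GL(1)-twisted L-factors.) There do not exist ε₁, ε₂, ε₃, ε' ∈ ℕ with ε₁, ε₂, ε₃, ε' ≤ 1, complex numbers t₁, t₂, t₃, t', u' ∈ ℂ, and an integer N' ≥ 1, such that: (central character equality) t₁ + t₂ + t₃ − (ε₁ + ε₂ + ε₃) = 2u' − N' + t' − ε' and ε₁ + ε₂ + ε₃ ≡ 1 + N' + ε' (mod 2); and (L-factor equality) for every δ ∈ {0,1} and every s ∈ ℂ, ∏_{i=1}^{3} π^{−(s + t_i − γ(ε_i,δ))/2}·Γ((s + t_i − γ(ε_i,δ))/2) = 2·(2π)^{−(s + u' − δ)}·Γ(s + u' − δ) · π^{−(s + t' − γ(ε',δ))/2}·Γ((s + t' − γ(ε',δ))/2), where γ(ε,δ) = 2 if ε = δ = 1 and γ(ε,δ) = 0 otherwise. -/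

import Mathlib

open Complex

/-- `γ(ε, δ) = 2` if `ε = δ = 1` and `0` otherwise. -/
def gam (e d : ℕ) : ℕ := if e = 1 ∧ d = 1 then 2 else 0

/-- The Archimedean factors in terms of `Gammaℝ` and `Gammaℂ`. -/
lemma Gammaℝ_eq_neg_div (z : ℂ) :
    (Real.pi : ℂ) ^ (-(z / 2)) * Complex.Gamma (z / 2) = Gammaℝ z := by
  rw [Gammaℝ_def, neg_div]

lemma Gammaℝ_eq_sub_two_mul {z : ℂ} (hz : 0 < (z - 2).re) :
    Gammaℝ z = Gammaℝ (z - 2) * (z - 2) / 2 / Real.pi := by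
  have h : z - 2 ≠ 0 := fun h => by simp [h] at hz
  simpa using Gammaℝ_add_two h

lemma Gammaℂ_eq_sub_one_mul {z : ℂ} (hz : 0 < (z - 1).re) :
    Gammaℂ z = Gammaℂ (z - 1) * (z - 1) / 2 / Real.pi := by
  have h : z - 1 ≠ 0 := fun h => by simp [h] at hz
  simpa using Gammaℂ_add_one h

lemma Gammaℂ_ne_zero_of_re_pos {z : ℂ} (hz : 0 < z.re) : Gammaℂ z ≠ 0 := by
  rw [Gammaℂ_def]
  refine mul_ne_zero (mul_ne_zero two_ne_zero ?_) (Complex.Gamma_ne_zero_of_re_pos hz)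
  simp [Complex.cpow_eq_zero_iff, Real.pi_ne_zero]

/-- The shift `s ↦ s + 2` turns an equality of `L`-factors into one of cubic polynomials. -/
lemma cubic_eq_of_Gamma_factors_eq {t₁ t₂ t₃ t u s : ℂ}
    (h : ∀ s, Gammaℝ (s + t₁) * Gammaℝ (s + t₂) * Gammaℝ (s + t₃) =
      Gammaℂ (s + u) * Gammaℝ (s + t))
    (h₁ : 0 < (s + t₁).re) (h₂ : 0 < (s + t₂).re) (h₃ : 0 < (s + t₃).re)
    (ht : 0 < (s + t).re) (hu : 0 < (s + u).re) :
    (s + t₁) * (s + t₂) * (s + t₃) = (s + u) * (s + u + 1) * (s + t) := by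
  have ne {z : ℂ} (hz : 0 < z.re) : z ≠ 0 := fun h => by simp [h] at hz
  have hu' : 0 < (s + u + 1).re := by
    rw [add_re, one_re]
    linarith
  have e := h (s + 2)
  rw [show s + 2 + t₁ = s + t₁ + 2 by ring, show s + 2 + t₂ = s + t₂ + 2 by ring,
    show s + 2 + t₃ = s + t₃ + 2 by ring, show s + 2 + t = s + t + 2 by ring,
    show s + 2 + u = s + u + 1 + 1 by ring, Gammaℝ_add_two (ne h₁), Gammaℝ_add_two (ne h₂),
    Gammaℝ_add_two (ne h₃), Gammaℝ_add_two (ne ht), Gammaℂ_add_one (ne hu'),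
    Gammaℂ_add_one (ne hu)] at e
  have hpi : (Real.pi : ℂ) ≠ 0 := by exact_mod_cast Real.pi_ne_zero
  have hL : Gammaℂ (s + u) * Gammaℝ (s + t) ≠ 0 :=
    mul_ne_zero (Gammaℂ_ne_zero_of_re_pos hu) (Gammaℝ_ne_zero_of_re_pos ht)
  field_simp at e
  apply mul_left_cancel₀ hL
  linear_combination e - (s + t₁) * (s + t₂) * (s + t₃) * h s

theorem GL3_real_no_mixed_parameters :
    ¬ ∃ (ε₁ ε₂ ε₃ ε' : ℕ) (t₁ t₂ t₃ t' u' : ℂ) (N' : ℤ),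
      ε₁ ≤ 1 ∧ ε₂ ≤ 1 ∧ ε₃ ≤ 1 ∧ ε' ≤ 1 ∧ 1 ≤ N' ∧
      (t₁ + t₂ + t₃ - ((ε₁ : ℂ) + ε₂ + ε₃) = 2 * u' - (N' : ℂ) + t' - (ε' : ℂ)) ∧
      ((ε₁ : ℤ) + ε₂ + ε₃ ≡ 1 + N' + (ε' : ℤ) [ZMOD 2]) ∧
      (∀ δ : ℕ, δ ≤ 1 → ∀ s : ℂ,
        (Real.pi : ℂ) ^ (-((s + t₁ - (gam ε₁ δ : ℂ)) / 2)) *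
            Complex.Gamma ((s + t₁ - (gam ε₁ δ : ℂ)) / 2) *
          ((Real.pi : ℂ) ^ (-((s + t₂ - (gam ε₂ δ : ℂ)) / 2)) *
            Complex.Gamma ((s + t₂ - (gam ε₂ δ : ℂ)) / 2)) *
          ((Real.pi : ℂ) ^ (-((s + t₃ - (gam ε₃ δ : ℂ)) / 2)) *
            Complex.Gamma ((s + t₃ - (gam ε₃ δ : ℂ)) / 2))
        = 2 * (2 * (Real.pi : ℂ)) ^ (-(s + u' - (δ : ℂ))) * Complex.Gamma (s + u' - (δ : ℂ)) *
          ((Real.pi : ℂ) ^ (-((s + t' - (gam ε' δ : ℂ)) / 2)) *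
            Complex.Gamma ((s + t' - (gam ε' δ : ℂ)) / 2))) := by
  rintro ⟨ε₁, ε₂, ε₃, ε', t₁, t₂, t₃, t', u', N', h₁, h₂, h₃, h', hN, hcentral, -, hL⟩
  simp only [Gammaℝ_eq_neg_div, ← Gammaℂ_def] at hL
  have hL₀ (s : ℂ) : Gammaℝ (s + t₁) * Gammaℝ (s + t₂) * Gammaℝ (s + t₃) =
      Gammaℂ (s + u') * Gammaℝ (s + t') := by
    simpa [gam] using hL 0 zero_le_one s
  have hL₁ := hL 1 le_rfl
  obtain ⟨M, hM₁, hM₂, hM₃, hM', hMu⟩ : ∃ M : ℝ, 2 < M + t₁.re ∧ 2 < M + t₂.re ∧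
      2 < M + t₃.re ∧ 2 < M + t'.re ∧ 2 < M + u'.re := by
    refine ⟨3 + |t₁.re| + |t₂.re| + |t₃.re| + |t'.re| + |u'.re|, ?_, ?_, ?_, ?_, ?_⟩ <;>
    linarith [neg_abs_le t₁.re, neg_abs_le t₂.re, neg_abs_le t₃.re, neg_abs_le t'.re,
      neg_abs_le u'.re, abs_nonneg t₁.re, abs_nonneg t₂.re, abs_nonneg t₃.re,
      abs_nonneg t'.re, abs_nonneg u'.re]
  have pos (n : ℕ) {t : ℂ} (ht : 2 < M + t.re) : 0 < ((M : ℂ) + n + t).re := by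
    simp only [add_re, ofReal_re, natCast_re]
    linarith [n.cast_nonneg (α := ℝ)]
  have hcubic (n : ℕ) := cubic_eq_of_Gamma_factors_eq (s := M + n) hL₀
    (pos n hM₁) (pos n hM₂) (pos n hM₃)
    (pos n hM') (pos n hMu)
  have hsum : t₁ + t₂ + t₃ = 2 * u' + 1 + t' := by
    have e₀ := hcubic 0
    have e₁ := hcubic 1
    have e₂ := hcubic 2
    push_cast at e₀ e₁ e₂
    linear_combination (e₂ - 2 * e₁ + e₀) / 2
  have hε : (ε₁ : ℤ) + ε₂ + ε₃ = 1 + N' + ε' := by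
    have : (ε₁ : ℂ) + ε₂ + ε₃ = 1 + N' + ε' := by linear_combination hsum - hcentral
    exact_mod_cast this
  have hpi : (Real.pi : ℂ) ≠ 0 := by exact_mod_cast Real.pi_ne_zero
  have hquot (n : ℕ) : (if ε₁ = 1 then ((M : ℂ) + n + t₁ - 2) / 2 / Real.pi else 1) *
      (if ε₂ = 1 then ((M : ℂ) + n + t₂ - 2) / 2 / Real.pi else 1) *
      (if ε₃ = 1 then ((M : ℂ) + n + t₃ - 2) / 2 / Real.pi else 1) =
      ((M : ℂ) + n + u' - 1) / 2 / Real.pi *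
      (if ε' = 1 then ((M : ℂ) + n + t' - 2) / 2 / Real.pi else 1) := by
    have shift {e : ℕ} {t : ℂ} (ht : 2 < M + t.re) :
        Gammaℝ (M + n + t) = Gammaℝ (M + n + t - gam e 1) *
          (if e = 1 then ((M : ℂ) + n + t - 2) / 2 / Real.pi else 1) ∧
        Gammaℝ (M + n + t - gam e 1) ≠ 0 := by
      have pos₂ : 0 < ((M : ℂ) + n + t - 2).re := by
        simp only [sub_re, add_re, ofReal_re, natCast_re, re_ofNat]
        linarith [n.cast_nonneg (α := ℝ)]
      by_cases he : e = 1
      · simp only [gam, he, and_self, if_true, Nat.cast_ofNat]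
        exact ⟨by rw [Gammaℝ_eq_sub_two_mul pos₂]; ring, Gammaℝ_ne_zero_of_re_pos pos₂⟩
      · simp only [gam, he, false_and, if_false, Nat.cast_zero, sub_zero, mul_one, true_and]
        exact Gammaℝ_ne_zero_of_re_pos (pos n ht)
    have posu : 0 < ((M : ℂ) + n + u' - 1).re := by
      simp only [sub_re, add_re, ofReal_re, natCast_re, one_re]
      linarith [n.cast_nonneg (α := ℝ)]
    have e₀ := hL₀ (M + n)
    have e₁ := hL₁ (M + n)
    rw [(shift (e := ε₁) hM₁).1, (shift (e := ε₂) hM₂).1, (shift (e := ε₃) hM₃).1,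
      (shift (e := ε') hM').1, Gammaℂ_eq_sub_one_mul posu] at e₀
    rw [Nat.cast_one] at e₁
    apply mul_left_cancel₀ (mul_ne_zero (Gammaℂ_ne_zero_of_re_pos posu) (shift (e := ε') hM').2)
    conv_lhs => rw [← e₁]
    linear_combination e₀
  have e₀ := hquot 0
  have e₁ := hquot 1
  have e₂ := hquot 2
  have e₃ := hquot 3
  push_cast at e₀ e₁ e₂ e₃
  have hpi₂ : (Real.pi : ℂ)⁻¹ ^ 2 ≠ 0 := pow_ne_zero _ (inv_ne_zero hpi)
  have hpi₃ : (Real.pi : ℂ)⁻¹ ^ 3 ≠ 0 := pow_ne_zero _ (inv_ne_zero hpi)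
  interval_cases ε₁ <;> interval_cases ε₂ <;> interval_cases ε₃ <;> interval_cases ε' <;>
  first
  | (push_cast at hε; omega)
  | (simp only [if_true, zero_ne_one, if_false, one_mul, mul_one] at e₀ e₁ e₂ e₃
     first
     | exact hpi₂ (by linear_combination 2 * (e₂ - 2 * e₁ + e₀))
     | exact hpi₃ (by linear_combination 4 / 3 * (e₃ - 3 * e₂ + 3 * e₁ - e₀)))
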